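/- Fix α ∈ [0,κ] and T > 0. Let ρ ∈ L¹(ℝ,ℂ) ∩ L^∞(ℝ,ℂ) and let μ̂₀ : ℝ → ℂ be measurable with ∫_ℝ (1+|ξ|^κ)|μ̂₀(ξ)| dξ < ∞. Assume: there exist σ > 0 and L₀ ≥ 1 such that for all L ≥ L₀, ∫_{|ξ|≥L} |ρ(ξ)| dξ ≤ L^{−σ} and ∫_{|ξ|≥L} |ξ|^κ |μ̂₀(ξ)| dξ ≤ L^{−σ}; ess sup_ξ |ξ|^κ|μ̂₀(ξ)| < ∞; and ∫_ℝ |ξ|^{2κ−1}|μ̂₀(ξ)| dξ < ∞. Then there exist τ₀ > 0, ε₀ ∈ (0,1) and C > 0, depending only on κ, the coefficients d_{κ−2j}, α, σ, T and the above norms, such that for all 0 < τ ≤ τ₀, all 0 < ε ≤ ε₀ and every integer n ≥ 1 with nτ ≤ T, ∫_ℝ |E_n(ξ)| dξ ≤ C τ ε^{1 + (κ−1)α/κ} ( 1 + τ^{1 − 1/κ} · log(1/ε) ). -/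

import Mathlib

open MeasureTheory Real
open scoped ENNReal NNReal

/-- The dispersion symbol `P(y) = Σ_{0 ≤ 2j < κ} d_{κ−2j} y^{κ−2j}`. -/
noncomputable def P (κ : ℕ) (d : ℕ → ℝ) (y : ℝ) : ℝ :=
  ∑ j ∈ Finset.range ((κ + 1) / 2), d (κ - 2 * j) * y ^ (κ - 2 * j)

/-- The Fourier-side form of `(ℐ_d(𝔲 − 𝔲_d))(nτ)`:
`E_n(ξ) = Σ_{k<n} ∫₀^τ ∫ e^{i(kτ+s)ε^αP(ξ)} ρ(ξ₁)
  (e^{−i(kτ+s)ε^αP(ξ−ξ₁/ε)} − e^{−ikτε^αP(ξ−ξ₁/ε)}) μ̂₀(ξ−ξ₁/ε) dξ₁ ds`. -/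
noncomputable def En (κ : ℕ) (d : ℕ → ℝ) (ρ μ₀ : ℝ → ℂ) (ε α τ : ℝ) (n : ℕ)
    (ξ : ℝ) : ℂ :=
  ∑ k ∈ Finset.range n,
    ∫ s in (0:ℝ)..τ,
      ∫ ξ₁ : ℝ,
        Complex.exp (Complex.I * Complex.ofReal (((k : ℝ) * τ + s) * ε ^ α * P κ d ξ)) *
          ρ ξ₁ *
          (Complex.exp (-Complex.I *
              Complex.ofReal (((k : ℝ) * τ + s) * ε ^ α * P κ d (ξ - ξ₁ / ε))) -
            Complex.exp (-Complex.I *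
              Complex.ofReal (((k : ℝ) * τ) * ε ^ α * P κ d (ξ - ξ₁ / ε)))) *
          μ₀ (ξ - ξ₁ / ε)

/-- The exponential sum `∑_{k < n} e^{ikθ}`. -/
noncomputable def expSum (n : ℕ) (θ : ℝ) : ℂ :=
  ∑ k ∈ Finset.range n, Complex.exp (Complex.I * Complex.ofReal (k * θ))

lemma continuous_expSum (n : ℕ) : Continuous (expSum n) := by
  unfold expSum
  fun_prop

lemma norm_expSum_le (n : ℕ) (θ : ℝ) : ‖expSum n θ‖ ≤ n := by
  refine (norm_sum_le _ _).trans ?_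
  simp only [Complex.norm_exp_I_mul_ofReal]
  simp

lemma expSum_neg (n : ℕ) (θ : ℝ) : expSum n (-θ) = (starRingEnd ℂ) (expSum n θ) := by
  simp only [expSum, map_sum, ← Complex.exp_conj, map_mul, Complex.conj_I, Complex.conj_ofReal]
  refine Finset.sum_congr rfl fun k _ => ?_
  push_cast
  ring_nf

lemma norm_expSum_neg (n : ℕ) (θ : ℝ) : ‖expSum n (-θ)‖ = ‖expSum n θ‖ := by
  rw [expSum_neg, RCLike.norm_conj]

lemma norm_expSum_le_pi_div (n : ℕ) {θ : ℝ} (h0 : 0 < θ) (h1 : θ ≤ 1) :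
    ‖expSum n θ‖ ≤ π / θ := by
  have hgeom : expSum n θ * (Complex.exp (Complex.I * θ) - 1)
      = Complex.exp (Complex.I * Complex.ofReal (n * θ)) - 1 := by
    have h : expSum n θ = ∑ k ∈ Finset.range n, Complex.exp (Complex.I * θ) ^ k := by
      refine Finset.sum_congr rfl fun k _ => ?_
      rw [← Complex.exp_nat_mul]
      push_cast
      ring_nf
    rw [h, geom_sum_mul, ← Complex.exp_nat_mul]
    push_cast
    ring_nf
  have hnum : ‖Complex.exp (Complex.I * Complex.ofReal (n * θ)) - 1‖ ≤ 2 := by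
    refine (norm_sub_le _ _).trans ?_
    rw [Complex.norm_exp_I_mul_ofReal]
    norm_num
  have hden : 2 / π * θ ≤ ‖Complex.exp (Complex.I * θ) - 1‖ := by
    rw [Complex.norm_exp_I_mul_ofReal_sub_one]
    have := Real.mul_le_sin (x := θ / 2) (by positivity) (by linarith [Real.pi_gt_three])
    calc 2 / π * θ = 2 * (2 / π * (θ / 2)) := by ring
      _ ≤ 2 * Real.sin (θ / 2) := by gcongr
      _ ≤ _ := Real.le_norm_self _
  rw [← hgeom, norm_mul] at hnum
  have hpi := Real.pi_pos
  have h3 : ‖expSum n θ‖ * (2 / π * θ) ≤ 2 :=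
    (mul_le_mul_of_nonneg_left hden (norm_nonneg _)).trans hnum
  rw [le_div_iff₀ h0]
  calc ‖expSum n θ‖ * θ = ‖expSum n θ‖ * (2 / π * θ) * (π / 2) := by field_simp
    _ ≤ 2 * (π / 2) := by gcongr
    _ = π := by ring

lemma sq_norm_expSum (n : ℕ) (θ : ℝ) :
    ‖expSum n θ‖ ^ 2 =
      ∑ j ∈ Finset.range n, ∑ k ∈ Finset.range n, Real.cos (((j : ℝ) - k) * θ) := by
  have hre : (expSum n θ).re = ∑ k ∈ Finset.range n, Real.cos (k * θ) := by
    rw [expSum, Complex.re_sum]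
    refine Finset.sum_congr rfl fun k _ => ?_
    rw [mul_comm, Complex.exp_ofReal_mul_I_re]
  have him : (expSum n θ).im = ∑ k ∈ Finset.range n, Real.sin (k * θ) := by
    rw [expSum, Complex.im_sum]
    refine Finset.sum_congr rfl fun k _ => ?_
    rw [mul_comm, Complex.exp_ofReal_mul_I_im]
  rw [← Complex.normSq_eq_norm_sq, Complex.normSq_apply, hre, him, Finset.sum_mul_sum,
    Finset.sum_mul_sum, ← Finset.sum_add_distrib]
  refine Finset.sum_congr rfl fun j _ => ?_
  rw [← Finset.sum_add_distrib]
  refine Finset.sum_congr rfl fun k _ => ?_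
  rw [sub_mul, Real.cos_sub]

lemma integral_cos_int_mul (a : ℝ) (m : ℤ) :
    ∫ θ in a..a + 2 * π, Real.cos (m * θ) = if m = 0 then 2 * π else 0 := by
  split_ifs with h
  · simp [h]
  · have hm : (m : ℝ) ≠ 0 := by exact_mod_cast h
    rw [intervalIntegral.integral_comp_mul_left _ hm, integral_cos, mul_add,
      Real.sin_add_int_mul_two_pi, sub_self, smul_zero]

lemma integral_sq_norm_expSum (n : ℕ) (a : ℝ) :
    ∫ θ in a..a + 2 * π, ‖expSum n θ‖ ^ 2 = 2 * π * n := by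
  simp_rw [sq_norm_expSum]
  rw [intervalIntegral.integral_finsetSum
    fun j _ => (by fun_prop : Continuous _).intervalIntegrable _ _]
  have h : ∀ j ∈ Finset.range n, ∫ θ in a..a + 2 * π,
      ∑ k ∈ Finset.range n, Real.cos (((j : ℝ) - k) * θ) = 2 * π := by
    intro j hj
    rw [intervalIntegral.integral_finsetSum
      fun k _ => (by fun_prop : Continuous _).intervalIntegrable _ _]
    have h' : ∀ k ∈ Finset.range n, ∫ θ in a..a + 2 * π, Real.cos (((j : ℝ) - k) * θ)
        = if j = k then 2 * π else 0 := by
      intro k _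
      have := integral_cos_int_mul a ((j : ℤ) - k)
      push_cast at this
      rw [this]
      congr 1
      rw [sub_eq_zero, Nat.cast_inj]
    rw [Finset.sum_congr rfl h', Finset.sum_ite_eq, if_pos hj]
  rw [Finset.sum_congr rfl h]
  simp [mul_comm]

lemma lintegral_period_expSum_le {n : ℕ} (hn : 1 ≤ n) (a : ℝ) :
    ∫⁻ θ in Set.Ioc a (a + 2 * π), ‖expSum n θ‖ₑ ≤ ENNReal.ofReal (2 * π * √n) := by
  have hn0 : (0 : ℝ) < n := by exact_mod_cast hn
  have hs : 0 < √(n : ℝ) := Real.sqrt_pos.2 hn0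
  have hle : a ≤ a + 2 * π := by linarith [Real.pi_pos]
  have hcont := continuous_expSum n
  have hval : ∫ θ in a..a + 2 * π, (√n + ‖expSum n θ‖ ^ 2 / √n) / 2 = 2 * π * √n := by
    rw [intervalIntegral.integral_div, intervalIntegral.integral_add
      ((by fun_prop : Continuous _).intervalIntegrable _ _)
      ((by fun_prop : Continuous _).intervalIntegrable _ _), intervalIntegral.integral_div,
      integral_sq_norm_expSum, intervalIntegral.integral_const, smul_eq_mul]
    field_simp
    rw [Real.sq_sqrt hn0.le]
    ring
  rw [← hval, intervalIntegral.integral_of_le hle, ofReal_integral_eq_lintegral_ofReal]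
  · refine lintegral_mono fun θ => ?_
    rw [← ofReal_norm]
    refine ENNReal.ofReal_le_ofReal ?_
    rw [le_div_iff₀ two_pos, ← sub_nonneg]
    have : √n + ‖expSum n θ‖ ^ 2 / √n - ‖expSum n θ‖ * 2
        = (√n - ‖expSum n θ‖) ^ 2 / √n := by
      field_simp
      ring
    rw [this]
    positivity
  · exact ((by fun_prop : Continuous _).integrableOn_Icc).mono_set Set.Ioc_subset_Icc_self
  · exact Filter.Eventually.of_forall fun θ => by positivity

lemma exists_lintegral_expSum_Ioi_one_le :
    ∃ C : ℝ, 0 ≤ C ∧ ∀ n : ℕ, 1 ≤ n →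
      ∫⁻ θ in Set.Ioi (1 : ℝ), ENNReal.ofReal (θ ^ (-(3 / 2) : ℝ)) * ‖expSum n θ‖ₑ ≤
        ENNReal.ofReal (C * √n) := by
  have hsum : Summable fun m : ℕ => ((m + 1 : ℕ) : ℝ) ^ (-(3 / 2) : ℝ) :=
    (summable_nat_add_iff 1).2 (Real.summable_nat_rpow.2 (by norm_num))
  refine ⟨(∑' m : ℕ, ((m + 1 : ℕ) : ℝ) ^ (-(3 / 2) : ℝ)) * (2 * π), by positivity,
    fun n hn => ?_⟩
  set I : ℕ → Set ℝ := fun m => Set.Ioc (1 + m * (2 * π)) (1 + m * (2 * π) + 2 * π) with hI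
  have hpi : (0 : ℝ) < 2 * π := by positivity
  have hcover : Set.Ioi (1 : ℝ) ⊆ ⋃ m, I m := by
    intro θ hθ
    have hθ' : 0 < (θ - 1) / (2 * π) := div_pos (sub_pos.2 hθ) hpi
    obtain ⟨m, hm⟩ : ∃ m : ℕ, ⌈(θ - 1) / (2 * π)⌉₊ = m + 1 :=
      ⟨_, (Nat.succ_pred_eq_of_pos (Nat.ceil_pos.2 hθ')).symm⟩
    obtain ⟨h1, h2⟩ := (Nat.ceil_eq_iff (Nat.succ_ne_zero m)).1 hm
    rw [Nat.succ_sub_one, lt_div_iff₀ hpi] at h1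
    rw [div_le_iff₀ hpi] at h2
    push_cast at h2
    exact Set.mem_iUnion.2 ⟨m, by linarith, by linarith⟩
  have hpiece : ∀ m, ∫⁻ θ in I m, ENNReal.ofReal (θ ^ (-(3 / 2) : ℝ)) * ‖expSum n θ‖ₑ ≤
      ENNReal.ofReal (((m + 1 : ℕ) : ℝ) ^ (-(3 / 2) : ℝ) * (2 * π * √n)) := by
    intro m
    rw [ENNReal.ofReal_mul (by positivity)]
    calc ∫⁻ θ in I m, ENNReal.ofReal (θ ^ (-(3 / 2) : ℝ)) * ‖expSum n θ‖ₑ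
        ≤ ∫⁻ θ in I m, ENNReal.ofReal (((m + 1 : ℕ) : ℝ) ^ (-(3 / 2) : ℝ)) *
            ‖expSum n θ‖ₑ := by
          refine setLIntegral_mono' measurableSet_Ioc fun θ hθ => ?_
          have hm : (m : ℝ) * 1 ≤ m * (2 * π) := by
            gcongr
            linarith [Real.pi_gt_three]
          have hθm : ((m + 1 : ℕ) : ℝ) ≤ θ := by
            push_cast
            linarith [hθ.1]
          have he : (-(3 / 2) : ℝ) ≤ 0 := by norm_num
          exact mul_le_mul_left (ENNReal.ofReal_le_ofReal
            (Real.rpow_le_rpow_of_nonpos (by positivity) hθm he)) _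
      _ = ENNReal.ofReal (((m + 1 : ℕ) : ℝ) ^ (-(3 / 2) : ℝ)) * ∫⁻ θ in I m, ‖expSum n θ‖ₑ :=
          lintegral_const_mul _ (continuous_expSum n).enorm.measurable
      _ ≤ _ := by
          gcongr
          exact lintegral_period_expSum_le hn _
  calc ∫⁻ θ in Set.Ioi (1 : ℝ), ENNReal.ofReal (θ ^ (-(3 / 2) : ℝ)) * ‖expSum n θ‖ₑ
      ≤ ∑' m, ∫⁻ θ in I m, ENNReal.ofReal (θ ^ (-(3 / 2) : ℝ)) * ‖expSum n θ‖ₑ :=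
        (lintegral_mono_set hcover).trans (lintegral_iUnion_le _ _)
    _ ≤ ∑' m : ℕ, ENNReal.ofReal (((m + 1 : ℕ) : ℝ) ^ (-(3 / 2) : ℝ) * (2 * π * √n)) :=
        ENNReal.tsum_le_tsum hpiece
    _ = _ := by
        rw [← ENNReal.ofReal_tsum_of_nonneg (fun m => by positivity) (hsum.mul_right _),
          tsum_mul_right, mul_assoc _ (2 * π)]

lemma lintegral_Ioi_rpow {p c : ℝ} (hp : p < -1) (hc : 0 < c) :
    ∫⁻ t in Set.Ioi c, ENNReal.ofReal (t ^ p) = ENNReal.ofReal (-c ^ (p + 1) / (p + 1)) := by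
  rw [← integral_Ioi_rpow_of_lt hp hc,
    ofReal_integral_eq_lintegral_ofReal (integrableOn_Ioi_rpow_of_lt hp hc)]
  filter_upwards [ae_restrict_mem measurableSet_Ioi] with t ht
  exact Real.rpow_nonneg (hc.trans ht).le _

/-- The resonant integral: the singularity of the weight at `θ = 0` is cut off at `τ / 8`, while
the resonances `θ ∈ 2πℤ` are handled in mean square over each period. -/
lemma exists_lintegral_expSum_weight_le {r T : ℝ} (hr : 1 / 2 ≤ r) (hr1 : r ≤ 1) :
    ∃ C : ℝ, 0 ≤ C ∧ ∀ τ : ℝ, 0 < τ → τ ≤ 1 → ∀ n : ℕ, 1 ≤ n → n * τ ≤ T →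
      ∫⁻ θ in Set.Ioi (τ / 8), ENNReal.ofReal (θ ^ (-r) * min 1 (1 / θ)) * ‖expSum n θ‖ₑ ≤
        ENNReal.ofReal (C * τ ^ (-r)) := by
  obtain ⟨C, hC0, hC⟩ := exists_lintegral_expSum_Ioi_one_le
  refine ⟨16 * π + C * √T, by positivity, fun τ hτ hτ1 n hn hnT => ?_⟩
  have hτ8 : 0 < τ / 8 := by positivity
  have hτr : 0 < τ ^ (-r) := Real.rpow_pos_of_pos hτ _
  have hcover : Set.Ioi (τ / 8) ⊆ Set.Ioc (τ / 8) 1 ∪ Set.Ioi 1 := by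
    intro θ hθ
    rcases le_or_gt θ 1 with h | h
    · exact Or.inl ⟨hθ, h⟩
    · exact Or.inr h
  have hlow : ∫⁻ θ in Set.Ioc (τ / 8) 1,
      ENNReal.ofReal (θ ^ (-r) * min 1 (1 / θ)) * ‖expSum n θ‖ₑ ≤
        ENNReal.ofReal (16 * π * τ ^ (-r)) := by
    calc ∫⁻ θ in Set.Ioc (τ / 8) 1,
          ENNReal.ofReal (θ ^ (-r) * min 1 (1 / θ)) * ‖expSum n θ‖ₑ
        ≤ ∫⁻ θ in Set.Ioc (τ / 8) 1, ENNReal.ofReal π * ENNReal.ofReal (θ ^ (-r - 1)) := by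
          refine setLIntegral_mono' measurableSet_Ioc fun θ hθ => ?_
          have hθ0 : 0 < θ := hτ8.trans hθ.1
          rw [← ofReal_norm, ← ENNReal.ofReal_mul (by positivity),
            ← ENNReal.ofReal_mul (by positivity)]
          refine ENNReal.ofReal_le_ofReal ?_
          calc θ ^ (-r) * min 1 (1 / θ) * ‖expSum n θ‖
              ≤ θ ^ (-r) * 1 * (π / θ) := by
                gcongr
                · exact min_le_left _ _
                · exact norm_expSum_le_pi_div n hθ0 hθ.2
            _ = π * θ ^ (-r - 1) := by
                rw [Real.rpow_sub_one hθ0.ne']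
                ring
      _ ≤ ∫⁻ θ in Set.Ioi (τ / 8), ENNReal.ofReal π * ENNReal.ofReal (θ ^ (-r - 1)) :=
          lintegral_mono_set Set.Ioc_subset_Ioi_self
      _ = ENNReal.ofReal (π * ((τ / 8) ^ (-r) / r)) := by
          rw [lintegral_const_mul _ (by fun_prop), lintegral_Ioi_rpow (by linarith) hτ8,
            ← ENNReal.ofReal_mul Real.pi_pos.le, sub_add_cancel, neg_div_neg_eq]
      _ ≤ ENNReal.ofReal (16 * π * τ ^ (-r)) := by
          refine ENNReal.ofReal_le_ofReal ?_
          have h8 : (τ / 8) ^ (-r) ≤ 8 * τ ^ (-r) := by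
            rw [Real.div_rpow hτ.le (by norm_num), Real.rpow_neg (by norm_num : (0 : ℝ) ≤ 8),
              div_inv_eq_mul, mul_comm]
            gcongr
            calc (8 : ℝ) ^ r ≤ 8 ^ (1 : ℝ) := Real.rpow_le_rpow_of_exponent_le (by norm_num) hr1
              _ = 8 := Real.rpow_one 8
          have : (τ / 8) ^ (-r) / r ≤ 16 * τ ^ (-r) := by
            rw [div_le_iff₀ (by linarith)]
            nlinarith
          nlinarith [Real.pi_pos]
  have hhigh : ∫⁻ θ in Set.Ioi 1,
      ENNReal.ofReal (θ ^ (-r) * min 1 (1 / θ)) * ‖expSum n θ‖ₑ ≤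
        ENNReal.ofReal (C * √T * τ ^ (-r)) := by
    calc ∫⁻ θ in Set.Ioi 1, ENNReal.ofReal (θ ^ (-r) * min 1 (1 / θ)) * ‖expSum n θ‖ₑ
        ≤ ∫⁻ θ in Set.Ioi 1, ENNReal.ofReal (θ ^ (-(3 / 2) : ℝ)) * ‖expSum n θ‖ₑ := by
          refine setLIntegral_mono' measurableSet_Ioi fun θ hθ => ?_
          have hθ0 : 0 < θ := zero_lt_one.trans hθ
          gcongr
          calc θ ^ (-r) * min 1 (1 / θ) ≤ θ ^ (-r) * (1 / θ) := by
                gcongr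
                exact min_le_right _ _
            _ = θ ^ (-r - 1) := by
                rw [Real.rpow_sub_one hθ0.ne']
                ring
            _ ≤ θ ^ (-(3 / 2) : ℝ) :=
                Real.rpow_le_rpow_of_exponent_le (le_of_lt hθ) (by linarith)
      _ ≤ ENNReal.ofReal (C * √n) := hC n hn
      _ ≤ _ := by
          refine ENNReal.ofReal_le_ofReal ?_
          rw [mul_assoc]
          gcongr
          calc √n ≤ √(T / τ) := Real.sqrt_le_sqrt ((le_div_iff₀ hτ).2 hnT)
            _ = √T * τ ^ (-(1 / 2) : ℝ) := by
                rw [Real.sqrt_div' _ hτ.le, Real.rpow_neg hτ.le, ← Real.sqrt_eq_rpow]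
                rfl
            _ ≤ √T * τ ^ (-r) := by
                gcongr ?_ * ?_
                exact Real.rpow_le_rpow_of_exponent_ge hτ hτ1 (by linarith)
  calc _ ≤ _ := lintegral_mono_set hcover
    _ ≤ _ := lintegral_union_le _ _ _
    _ ≤ _ := add_le_add hlow hhigh
    _ = _ := by
        rw [← ENNReal.ofReal_add (by positivity) (by positivity), add_mul]

/-- The sum of the absolute values of the coefficients of `P`. -/
noncomputable def coeffNorm (κ : ℕ) (d : ℕ → ℝ) : ℝ :=
  ∑ j ∈ Finset.range ((κ + 1) / 2), |d (κ - 2 * j)|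

/-- The derivative of the symbol `P`. -/
noncomputable def derivP (κ : ℕ) (d : ℕ → ℝ) (y : ℝ) : ℝ :=
  ∑ j ∈ Finset.range ((κ + 1) / 2), d (κ - 2 * j) * ((κ - 2 * j : ℕ) * y ^ (κ - 2 * j - 1))

section Symbol

variable {κ : ℕ} {d : ℕ → ℝ}

lemma coeffNorm_nonneg : 0 ≤ coeffNorm κ d :=
  Finset.sum_nonneg fun _ _ => abs_nonneg _

lemma one_le_coeffNorm (hκ : 2 ≤ κ) (hd : d κ = 1) : 1 ≤ coeffNorm κ d := by
  have h := Finset.single_le_sum (f := fun j => |d (κ - 2 * j)|) (fun j _ => abs_nonneg _)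
    (Finset.mem_range.2 (by omega : 0 < (κ + 1) / 2))
  simpa [hd, coeffNorm] using h

lemma continuous_P : Continuous (P κ d) := by
  unfold P
  fun_prop

lemma hasDerivAt_P (y : ℝ) : HasDerivAt (P κ d) (derivP κ d y) y :=
  HasDerivAt.fun_sum fun j _ => (hasDerivAt_pow (κ - 2 * j) y).const_mul _

lemma P_neg (y : ℝ) : P κ d (-y) = (-1) ^ κ * P κ d y := by
  rw [P, P, Finset.mul_sum]
  refine Finset.sum_congr rfl fun j hj => ?_
  have hj' := Finset.mem_range.1 hj
  have hpar : (-1 : ℝ) ^ κ = (-1) ^ (κ - 2 * j) := by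
    conv_lhs => rw [← Nat.sub_add_cancel (by omega : 2 * j ≤ κ), pow_add, pow_mul]
    simp
  rw [neg_pow, hpar]
  ring

lemma abs_P_le {y M : ℝ} (hM : 1 ≤ M) (hy : |y| ≤ M) : |P κ d y| ≤ coeffNorm κ d * M ^ κ := by
  rw [coeffNorm, Finset.sum_mul]
  refine (Finset.abs_sum_le_sum_abs _ _).trans (Finset.sum_le_sum fun j _ => ?_)
  rw [abs_mul, abs_pow]
  gcongr
  exact (pow_le_pow_left₀ (abs_nonneg y) hy _).trans (pow_le_pow_right₀ hM (Nat.sub_le _ _))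

lemma coeffNorm_eq (hκ : 2 ≤ κ) (hd : d κ = 1) :
    coeffNorm κ d = ∑ j ∈ Finset.range ((κ + 1) / 2 - 1), |d (κ - 2 * (j + 1))| + 1 := by
  obtain ⟨m, hm⟩ : ∃ m, (κ + 1) / 2 = m + 1 := ⟨(κ + 1) / 2 - 1, by omega⟩
  rw [coeffNorm, hm, Finset.sum_range_succ']
  simp [hd]

lemma half_pow_le_P (hκ : 2 ≤ κ) (hd : d κ = 1) {y : ℝ} (hy : 2 * coeffNorm κ d ≤ y) :
    y ^ κ / 2 ≤ P κ d y := by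
  have hB := one_le_coeffNorm hκ hd
  have hy1 : 1 ≤ y := by linarith
  obtain ⟨m, hm⟩ : ∃ m, (κ + 1) / 2 = m + 1 := ⟨(κ + 1) / 2 - 1, by omega⟩
  have hP : P κ d y =
      ∑ j ∈ Finset.range m, d (κ - 2 * (j + 1)) * y ^ (κ - 2 * (j + 1)) + y ^ κ := by
    rw [P, hm, Finset.sum_range_succ']
    simp [hd]
  have hrest : |∑ j ∈ Finset.range m, d (κ - 2 * (j + 1)) * y ^ (κ - 2 * (j + 1))| ≤
      coeffNorm κ d * y ^ (κ - 1) := by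
    calc _ ≤ ∑ j ∈ Finset.range m, |d (κ - 2 * (j + 1))| * y ^ (κ - 1) := by
          refine (Finset.abs_sum_le_sum_abs _ _).trans (Finset.sum_le_sum fun j _ => ?_)
          rw [abs_mul, abs_of_nonneg (by positivity : 0 ≤ y ^ (κ - 2 * (j + 1)))]
          gcongr ?_ * ?_
          exact pow_le_pow_right₀ hy1 (by omega)
      _ ≤ _ := by
          rw [← Finset.sum_mul, coeffNorm_eq hκ hd, hm, Nat.add_sub_cancel]
          gcongr
          linarith
  have hpow : coeffNorm κ d * y ^ (κ - 1) ≤ y ^ κ / 2 := by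
    have : y ^ κ = y * y ^ (κ - 1) := (mul_pow_sub_one (by omega) y).symm
    rw [this]
    nlinarith [pow_nonneg (by linarith : 0 ≤ y) (κ - 1)]
  rw [hP]
  linarith [(abs_le.1 hrest).1]

lemma half_pow_le_derivP (hκ : 2 ≤ κ) (hd : d κ = 1) {y : ℝ} (hy : 2 * coeffNorm κ d ≤ y) :
    y ^ (κ - 1) / 2 ≤ derivP κ d y := by
  have hB := one_le_coeffNorm hκ hd
  have hy1 : 1 ≤ y := by linarith
  have hκ1 : (1 : ℝ) ≤ κ := by exact_mod_cast (by omega : 1 ≤ κ)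
  obtain ⟨m, hm⟩ : ∃ m, (κ + 1) / 2 = m + 1 := ⟨(κ + 1) / 2 - 1, by omega⟩
  have hP : derivP κ d y = ∑ j ∈ Finset.range m,
      d (κ - 2 * (j + 1)) * ((κ - 2 * (j + 1) : ℕ) * y ^ (κ - 2 * (j + 1) - 1)) +
        κ * y ^ (κ - 1) := by
    rw [derivP, hm, Finset.sum_range_succ']
    simp [hd]
  have hrest : |∑ j ∈ Finset.range m,
      d (κ - 2 * (j + 1)) * ((κ - 2 * (j + 1) : ℕ) * y ^ (κ - 2 * (j + 1) - 1))| ≤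
      coeffNorm κ d * (κ * y ^ (κ - 2)) := by
    calc _ ≤ ∑ j ∈ Finset.range m, |d (κ - 2 * (j + 1))| * (κ * y ^ (κ - 2)) := by
          refine (Finset.abs_sum_le_sum_abs _ _).trans (Finset.sum_le_sum fun j _ => ?_)
          rw [abs_mul, abs_of_nonneg (by positivity :
            0 ≤ ((κ - 2 * (j + 1) : ℕ) : ℝ) * y ^ (κ - 2 * (j + 1) - 1))]
          gcongr ?_ * (?_ * ?_)
          · exact_mod_cast Nat.sub_le _ _
          · exact pow_le_pow_right₀ hy1 (by omega)
      _ ≤ _ := by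
          rw [← Finset.sum_mul, coeffNorm_eq hκ hd, hm, Nat.add_sub_cancel]
          gcongr
          linarith
  have hpow : coeffNorm κ d * (κ * y ^ (κ - 2)) ≤ κ * y ^ (κ - 1) / 2 := by
    have : y ^ (κ - 1) = y * y ^ (κ - 2) := by
      rw [← pow_succ']
      congr 1
      omega
    rw [this]
    nlinarith [mul_nonneg (by linarith : (0 : ℝ) ≤ κ)
      (pow_nonneg (by linarith : 0 ≤ y) (κ - 2))]
  have hk : y ^ (κ - 1) ≤ κ * y ^ (κ - 1) :=
    le_mul_of_one_le_left (pow_nonneg (by linarith) _) hκ1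
  rw [hP]
  linarith [(abs_le.1 hrest).1]

/-- The time integral `∫₀^τ e^{isa} (e^{-isb} − 1) ds` produced by a single step. -/
noncomputable def stepIntegral (τ a b : ℝ) : ℂ :=
  ∫ s in (0 : ℝ)..τ, Complex.exp (Complex.I * Complex.ofReal (s * a)) *
    (Complex.exp (Complex.I * Complex.ofReal (-(s * b))) - 1)

lemma continuous_stepIntegral (τ : ℝ) :
    Continuous fun p : ℝ × ℝ => stepIntegral τ p.1 p.2 := by
  unfold stepIntegral
  exact intervalIntegral.continuous_parametric_intervalIntegral_of_continuous'
    (by unfold Function.uncurry; fun_prop) _ _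

lemma norm_exp_neg_mul_sub_one_le {τ s : ℝ} (hs : s ∈ Set.uIoc 0 τ) (hτ : 0 ≤ τ) (b : ℝ) :
    ‖Complex.exp (Complex.I * Complex.ofReal (-(s * b))) - 1‖ ≤ τ * |b| := by
  rw [Set.uIoc_of_le hτ] at hs
  refine Real.norm_exp_I_mul_ofReal_sub_one_le.trans ?_
  rw [Real.norm_eq_abs, abs_neg, abs_mul, abs_of_pos hs.1]
  gcongr
  exact hs.2

lemma norm_stepIntegral_le {τ : ℝ} (hτ : 0 ≤ τ) (a b : ℝ) :
    ‖stepIntegral τ a b‖ ≤ τ * |b| * τ := by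
  have h := intervalIntegral.norm_integral_le_of_norm_le_const
    (f := fun s : ℝ => Complex.exp (Complex.I * Complex.ofReal (s * a)) *
      (Complex.exp (Complex.I * Complex.ofReal (-(s * b))) - 1))
    (a := 0) (b := τ) (C := τ * |b|) fun s hs => by
      rw [norm_mul, Complex.norm_exp_I_mul_ofReal, one_mul]
      exact norm_exp_neg_mul_sub_one_le hs hτ b
  rwa [sub_zero, abs_of_nonneg hτ] at h

lemma norm_stepIntegral_le_div {τ : ℝ} (hτ : 0 < τ) {a : ℝ} (ha : a ≠ 0) (b : ℝ) :
    ‖stepIntegral τ a b‖ ≤ 2 * τ * |b| / |a| := by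
  have haC : (Complex.I * a : ℂ) ≠ 0 := by simp [ha]
  have hu : ∀ s : ℝ, HasDerivAt
      (fun s : ℝ => Complex.exp (Complex.I * Complex.ofReal (-(s * b))) - 1)
      (Complex.exp (Complex.I * Complex.ofReal (-(s * b))) * (Complex.I * -b)) s := by
    intro s
    have h1 : HasDerivAt (fun s : ℝ => Complex.I * Complex.ofReal (-(s * b)))
        (Complex.I * -b) s := by
      have := (((hasDerivAt_id s).mul_const b).neg.ofReal_comp).const_mul Complex.I
      simpa using this
    exact h1.cexp.sub_const 1
  have hv : ∀ s : ℝ, HasDerivAt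
      (fun s : ℝ => Complex.exp (Complex.I * Complex.ofReal (s * a)) / (Complex.I * a))
      (Complex.exp (Complex.I * Complex.ofReal (s * a))) s := by
    intro s
    have h1 : HasDerivAt (fun s : ℝ => Complex.I * Complex.ofReal (s * a))
        (Complex.I * a) s := by
      have := (((hasDerivAt_id s).mul_const a).ofReal_comp).const_mul Complex.I
      simpa using this
    have := h1.cexp.div_const (Complex.I * a)
    rwa [mul_div_cancel_right₀ _ haC] at this
  have hparts := intervalIntegral.integral_mul_deriv_eq_deriv_mul (a := 0) (b := τ)
    (fun s _ => hu s) (fun s _ => hv s)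
    ((by fun_prop : Continuous _).intervalIntegrable _ _)
    ((by fun_prop : Continuous _).intervalIntegrable _ _)
  have hS : stepIntegral τ a b = ∫ s in (0 : ℝ)..τ,
      (Complex.exp (Complex.I * Complex.ofReal (-(s * b))) - 1) *
        Complex.exp (Complex.I * Complex.ofReal (s * a)) := by
    simp only [stepIntegral, mul_comm]
  have hbd : ‖(Complex.exp (Complex.I * Complex.ofReal (-(τ * b))) - 1) *
      (Complex.exp (Complex.I * Complex.ofReal (τ * a)) / (Complex.I * a))‖ ≤
        τ * |b| * (1 / |a|) := by
    rw [norm_mul, norm_div, Complex.norm_exp_I_mul_ofReal, norm_mul, Complex.norm_I, one_mul,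
      Complex.norm_real, Real.norm_eq_abs]
    gcongr
    exact norm_exp_neg_mul_sub_one_le (by rw [Set.uIoc_of_le hτ.le]; simp [hτ]) hτ.le b
  have hint : ‖∫ s in (0 : ℝ)..τ,
      Complex.exp (Complex.I * Complex.ofReal (-(s * b))) * (Complex.I * -b) *
        (Complex.exp (Complex.I * Complex.ofReal (s * a)) / (Complex.I * a))‖ ≤
        |b| * (1 / |a|) * τ := by
    have h := intervalIntegral.norm_integral_le_of_norm_le_const
      (f := fun s : ℝ =>
        Complex.exp (Complex.I * Complex.ofReal (-(s * b))) * (Complex.I * -b) *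
        (Complex.exp (Complex.I * Complex.ofReal (s * a)) / (Complex.I * a)))
      (a := 0) (b := τ) (C := |b| * (1 / |a|)) fun s _ => by
        rw [norm_mul, norm_div, Complex.norm_exp_I_mul_ofReal, norm_mul, norm_mul, norm_mul,
          Complex.norm_I, Complex.norm_exp_I_mul_ofReal]
        simp
    rwa [sub_zero, abs_of_nonneg hτ.le] at h
  rw [hS, hparts]
  simp only [zero_mul, neg_zero, Complex.ofReal_zero, mul_zero, Complex.exp_zero, sub_self,
    sub_zero]
  refine (norm_sub_le _ _).trans ((add_le_add hbd hint).trans_eq ?_)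
  ring

/-- Change of variables `θ = τe(P(y) − q)` on the region where `P` is strictly increasing and
dominates `q`. -/
lemma exists_lintegral_expSum_P_le (hκ : 2 ≤ κ) (hd : d κ = 1) (T : ℝ) :
    ∃ C : ℝ, 0 ≤ C ∧ ∀ τ e A q : ℝ, 0 < τ → τ ≤ 1 → 0 < e → 2 * coeffNorm κ d ≤ A →
      e ^ (-(1 / κ) : ℝ) ≤ A → |q| ≤ A ^ κ / 4 → ∀ n : ℕ, 1 ≤ n → n * τ ≤ T →
      ∫⁻ y in Set.Ioi A, ‖expSum n (τ * (e * P κ d y - e * q))‖ₑ *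
        ENNReal.ofReal (min τ (2 / (e * P κ d y))) ≤ ENNReal.ofReal (C * e ^ (-(1 / κ) : ℝ)) := by
  have hκ0 : (0 : ℝ) < κ := by exact_mod_cast (by omega : 0 < κ)
  have hκ2 : (2 : ℝ) ≤ κ := by exact_mod_cast hκ
  set r : ℝ := 1 - 1 / κ with hr
  have hinv : (1 : ℝ) / κ ≤ 1 / 2 := one_div_le_one_div_of_le two_pos hκ2
  have hinv0 : (0 : ℝ) < 1 / κ := by positivity
  obtain ⟨C, hC0, hC⟩ := exists_lintegral_expSum_weight_le (r := r) (T := T)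
    (by linarith) (by linarith)
  set B := coeffNorm κ d with hB
  have hB1 : 1 ≤ B := one_le_coeffNorm hκ hd
  refine ⟨12 * B * C, by positivity, fun τ e A q hτ hτ1 he hA hAe hq n hn hnT => ?_⟩
  set l := τ * e with hl
  have hl0 : 0 < l := by positivity
  have hA0 : 0 < A := by linarith
  set f : ℝ → ℝ := fun y => τ * (e * P κ d y - e * q) with hf
  set f' : ℝ → ℝ := fun y => l * derivP κ d y with hf'
  set c : ℝ := 12 * B * τ * l ^ (r - 1) with hc
  have hc0 : 0 ≤ c := by positivity
  have hderiv : ∀ y, HasDerivAt f (f' y) y := fun y => by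
    have h := (((hasDerivAt_P (κ := κ) (d := d) y).const_mul e).sub_const (e * q)).const_mul τ
    rwa [← mul_assoc] at h
  have hderivP : ∀ y ∈ Set.Ioi A, y ^ (κ - 1) / 2 ≤ derivP κ d y := fun y hy =>
    half_pow_le_derivP hκ hd (hA.trans (le_of_lt hy))
  have hf'pos : ∀ y ∈ Set.Ioi A, 0 < f' y := fun y hy => by
    have : 0 < y ^ (κ - 1) := pow_pos (hA0.trans hy) _
    exact mul_pos hl0 (by linarith [hderivP y hy])
  have hinj : Set.InjOn f (Set.Ioi A) := by
    refine (strictMonoOn_of_deriv_pos (convex_Ioi A)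
      (fun y _ => (hderiv y).continuousAt.continuousWithinAt) fun y hy => ?_).injOn
    rw [interior_Ioi] at hy
    rw [(hderiv y).deriv]
    exact hf'pos y hy
  have hbounds : ∀ y ∈ Set.Ioi A, 0 < P κ d y ∧ τ / 8 < f y ∧ 2 * f y ≤ 3 * (l * P κ d y) ∧
      f y ^ r ≤ 4 * B * l ^ r * derivP κ d y := by
    intro y hy
    have hy0 : 0 < y := hA0.trans hy
    have hPlow := half_pow_le_P hκ hd (hA.trans (le_of_lt hy))
    have hPup : P κ d y ≤ B * y ^ κ := (le_abs_self _).trans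
      (abs_P_le (by linarith [Set.mem_Ioi.1 hy]) (abs_of_pos hy0).le)
    have hAy : A ^ κ ≤ y ^ κ := pow_le_pow_left₀ hA0.le (le_of_lt hy) κ
    have hyκ : 0 < y ^ κ := by positivity
    obtain ⟨hq1, hq2⟩ := abs_le.1 hq
    have hey : 1 ≤ e * y ^ κ := by
      have h : (e ^ (-(1 / κ) : ℝ)) ^ κ ≤ y ^ κ :=
        pow_le_pow_left₀ (by positivity) (hAe.trans (le_of_lt hy)) κ
      rw [← Real.rpow_mul_natCast he.le, neg_mul, one_div_mul_cancel hκ0.ne',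
        Real.rpow_neg_one] at h
      calc 1 = e * e⁻¹ := (mul_inv_cancel₀ he.ne').symm
        _ ≤ e * y ^ κ := by gcongr
    have hfl : f y = l * (P κ d y - q) := by simp only [hf, hl]; ring
    have hlow : τ / 4 ≤ f y := by
      calc τ / 4 = τ * 1 / 4 := by ring
        _ ≤ τ * (e * y ^ κ) / 4 := by gcongr
        _ = l * (y ^ κ / 4) := by rw [hl]; ring
        _ ≤ l * (P κ d y - q) := by gcongr; linarith
        _ = f y := hfl.symm
    refine ⟨by linarith, by linarith, ?_, ?_⟩
    · rw [hfl]
      nlinarith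
    · have hup : f y ≤ 2 * B * l * y ^ κ := by
        rw [hfl]
        nlinarith [mul_le_mul_of_nonneg_right hB1 hyκ.le]
      have hpow : (y ^ κ) ^ r = y ^ (κ - 1) := by
        rw [← Real.rpow_natCast, ← Real.rpow_mul hy0.le, ← Real.rpow_natCast y (κ - 1)]
        congr 1
        rw [hr, Nat.cast_sub (by omega)]
        field_simp
        simp
      have h2B : (2 * B) ^ r ≤ 2 * B := by
        calc (2 * B) ^ r ≤ (2 * B) ^ (1 : ℝ) :=
              Real.rpow_le_rpow_of_exponent_le (by linarith) (by linarith)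
          _ = 2 * B := Real.rpow_one _
      calc f y ^ r ≤ (2 * B * l * y ^ κ) ^ r :=
            Real.rpow_le_rpow (by linarith) hup (by linarith)
        _ = (2 * B) ^ r * l ^ r * y ^ (κ - 1) := by
            rw [Real.mul_rpow (by positivity) (by positivity),
              Real.mul_rpow (by positivity) (by positivity), hpow]
        _ ≤ 2 * B * l ^ r * (2 * derivP κ d y) := by
            gcongr
            linarith [hderivP y hy]
        _ = _ := by ring
  have hpoint : ∀ y ∈ Set.Ioi A, min τ (2 / (e * P κ d y)) ≤
      f' y * (c * (f y ^ (-r) * min 1 (1 / f y))) := by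
    intro y hy
    obtain ⟨hP0, hf0, hfP, hfr⟩ := hbounds y hy
    have hfy : 0 < f y := lt_trans (by positivity) hf0
    have hfr0 : 0 < f y ^ r := Real.rpow_pos_of_pos hfy r
    have hmin : min τ (2 / (e * P κ d y)) ≤ 3 * τ * min 1 (1 / f y) := by
      rw [mul_min_of_nonneg _ _ (by positivity)]
      refine min_le_min (by linarith) ?_
      rw [mul_one_div, div_le_div_iff₀ (by positivity) hfy]
      calc 2 * f y ≤ 3 * (l * P κ d y) := hfP
        _ = _ := by rw [hl]; ring
    have hone : 1 ≤ 4 * B * l ^ r * derivP κ d y * f y ^ (-r) := by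
      rw [Real.rpow_neg hfy.le, ← div_eq_mul_inv]
      exact (one_le_div hfr0).2 hfr
    calc min τ (2 / (e * P κ d y)) ≤ 1 * (3 * τ * min 1 (1 / f y)) := by rwa [one_mul]
      _ ≤ 4 * B * l ^ r * derivP κ d y * f y ^ (-r) * (3 * τ * min 1 (1 / f y)) := by
          gcongr
      _ = _ := by
          rw [hc, hf', Real.rpow_sub_one hl0.ne']
          field_simp
          ring
  set g : ℝ → ℝ≥0∞ := fun θ => ENNReal.ofReal c *
    (ENNReal.ofReal (θ ^ (-r) * min 1 (1 / θ)) * ‖expSum n θ‖ₑ) with hg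
  calc ∫⁻ y in Set.Ioi A, ‖expSum n (f y)‖ₑ * ENNReal.ofReal (min τ (2 / (e * P κ d y)))
      ≤ ∫⁻ y in Set.Ioi A, ENNReal.ofReal |f' y| * g (f y) := by
        refine setLIntegral_mono' measurableSet_Ioi fun y hy => ?_
        rw [hg, ← mul_assoc, ← mul_assoc, mul_comm, ← ENNReal.ofReal_mul (abs_nonneg _),
          ← ENNReal.ofReal_mul (by positivity), abs_of_pos (hf'pos y hy), mul_assoc (f' y)]
        gcongr
        exact hpoint y hy
    _ = ∫⁻ θ in f '' Set.Ioi A, g θ :=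
        (lintegral_image_eq_lintegral_abs_deriv_mul measurableSet_Ioi
          (fun y _ => (hderiv y).hasDerivWithinAt) hinj g).symm
    _ ≤ ∫⁻ θ in Set.Ioi (τ / 8), g θ := by
        refine lintegral_mono_set ?_
        rintro _ ⟨y, hy, rfl⟩
        exact (hbounds y hy).2.1
    _ ≤ ENNReal.ofReal c * ENNReal.ofReal (C * τ ^ (-r)) := by
        rw [lintegral_const_mul' _ _ ENNReal.ofReal_ne_top]
        gcongr
        exact hC τ hτ hτ1 n hn hnT
    _ = ENNReal.ofReal (12 * B * C * e ^ (-(1 / κ) : ℝ)) := by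
        rw [← ENNReal.ofReal_mul hc0, hc, hl, Real.mul_rpow hτ.le he.le,
          Real.rpow_sub_one hτ.ne', Real.rpow_neg hτ.le, (by rw [hr]; ring : r - 1 = -(1 / κ))]
        congr 1
        have := Real.rpow_pos_of_pos hτ r
        field_simp

lemma lintegral_le_split_abs (A : ℝ) (F : ℝ → ℝ≥0∞) :
    ∫⁻ ξ, F ξ ≤ (∫⁻ ξ in Set.Icc (-A) A, F ξ) +
      ((∫⁻ y in Set.Ioi A, F y) + ∫⁻ y in Set.Ioi A, F (-y)) := by
  have hneg : ∫⁻ y in Set.Ioi A, F (-y) = ∫⁻ ξ in Set.Iio (-A), F ξ := by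
    have h := (Measure.measurePreserving_neg (volume : Measure ℝ)).setLIntegral_comp_preimage_emb
      (MeasurableEquiv.neg ℝ).measurableEmbedding F (Set.Iio (-A))
    rw [← h]
    congr 2
    ext y
    simp
  have hcover : Set.univ ⊆ Set.Icc (-A) A ∪ (Set.Ioi A ∪ Set.Iio (-A)) := by
    intro ξ _
    simp only [Set.mem_union, Set.mem_Icc, Set.mem_Ioi, Set.mem_Iio]
    grind
  rw [hneg, ← setLIntegral_univ]
  calc _ ≤ _ := lintegral_mono_set hcover
    _ ≤ _ := lintegral_union_le _ _ _
    _ ≤ _ := by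
        gcongr
        exact lintegral_union_le _ _ _

/-- The kernel through which `En` acts on `μ₀`, up to the factor `ρ`. -/
noncomputable def stepKernel (κ : ℕ) (d : ℕ → ℝ) (n : ℕ) (τ e ξ η : ℝ) : ℂ :=
  expSum n (τ * (e * P κ d ξ - e * P κ d η)) * stepIntegral τ (e * P κ d ξ) (e * P κ d η)

lemma continuous_stepKernel (n : ℕ) (τ e : ℝ) :
    Continuous fun p : ℝ × ℝ => stepKernel κ d n τ e p.1 p.2 := by
  have hP := continuous_P (κ := κ) (d := d)
  refine Continuous.mul ((continuous_expSum n).comp (by fun_prop)) ?_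
  exact (continuous_stepIntegral τ).comp
    (by fun_prop : Continuous fun p : ℝ × ℝ => (e * P κ d p.1, e * P κ d p.2))

lemma norm_stepKernel_le (n : ℕ) {τ e : ℝ} (hτ : 0 ≤ τ) (he : 0 ≤ e) (ξ η : ℝ) :
    ‖stepKernel κ d n τ e ξ η‖ ≤ n * (τ * (e * |P κ d η|) * τ) := by
  rw [stepKernel, norm_mul]
  gcongr
  · exact norm_expSum_le _ _
  · refine (norm_stepIntegral_le hτ _ _).trans_eq ?_
    rw [abs_mul, abs_of_nonneg he]

lemma exists_lintegral_outer_stepKernel_le (hκ : 2 ≤ κ) (hd : d κ = 1) (T : ℝ) :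
    ∃ C : ℝ, 0 ≤ C ∧ ∀ τ e A η : ℝ, 0 < τ → τ ≤ 1 → 0 < e → 2 * coeffNorm κ d ≤ A →
      e ^ (-(1 / κ) : ℝ) ≤ A → |P κ d η| ≤ A ^ κ / 4 → ∀ n : ℕ, 1 ≤ n → n * τ ≤ T →
      ∀ S : ℝ → ℝ, (S = id ∨ S = Neg.neg) →
      ∫⁻ y in Set.Ioi A, ‖stepKernel κ d n τ e (S y) η‖ₑ ≤
        ENNReal.ofReal (C * (τ * (e * |P κ d η|) * e ^ (-(1 / κ) : ℝ))) := by
  obtain ⟨C, hC0, hC⟩ := exists_lintegral_expSum_P_le hκ hd T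
  refine ⟨C, hC0, fun τ e A η hτ hτ1 he hA hAe hη n hn hnT S hS => ?_⟩
  obtain ⟨q, hq, hSP⟩ : ∃ q, |q| ≤ A ^ κ / 4 ∧ ∀ y, |P κ d (S y)| = |P κ d y| ∧
      ‖expSum n (τ * (e * P κ d (S y) - e * P κ d η))‖ =
        ‖expSum n (τ * (e * P κ d y - e * q))‖ := by
    have hplus : (∀ y, P κ d (S y) = P κ d y) ∨ ∀ y, P κ d (S y) = -P κ d y := by
      rcases hS with rfl | rfl
      · exact Or.inl fun y => rfl
      · rcases neg_one_pow_eq_or ℝ κ with h | h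
        · exact Or.inl fun y => by rw [P_neg, h, one_mul]
        · exact Or.inr fun y => by rw [P_neg, h, neg_one_mul]
    rcases hplus with h | h
    · exact ⟨P κ d η, hη, fun y => by rw [h y]; exact ⟨rfl, rfl⟩⟩
    · refine ⟨-P κ d η, by rwa [abs_neg], fun y => ?_⟩
      rw [h y, abs_neg, ← norm_expSum_neg]
      refine ⟨rfl, ?_⟩
      ring_nf
  have hB1 := one_le_coeffNorm hκ hd
  calc ∫⁻ y in Set.Ioi A, ‖stepKernel κ d n τ e (S y) η‖ₑ
      ≤ ∫⁻ y in Set.Ioi A, ENNReal.ofReal (τ * (e * |P κ d η|)) *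
          (‖expSum n (τ * (e * P κ d y - e * q))‖ₑ *
            ENNReal.ofReal (min τ (2 / (e * P κ d y)))) := by
        refine setLIntegral_mono' measurableSet_Ioi fun y hy => ?_
        have hy0 : 0 < y := lt_of_lt_of_le (by linarith) (le_of_lt hy)
        have hPy : 0 < P κ d y := lt_of_lt_of_le (by positivity)
          (half_pow_le_P hκ hd (hA.trans (le_of_lt hy)))
        have habs : |e * P κ d (S y)| = e * P κ d y := by
          rw [abs_mul, (hSP y).1, abs_of_pos he, abs_of_pos hPy]
        have hne : e * P κ d (S y) ≠ 0 := abs_pos.1 (by rw [habs]; positivity)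
        have hstep : ‖stepIntegral τ (e * P κ d (S y)) (e * P κ d η)‖ ≤
            τ * (e * |P κ d η|) * min τ (2 / (e * P κ d y)) := by
          have hb : |e * P κ d η| = e * |P κ d η| := by rw [abs_mul, abs_of_pos he]
          rw [mul_min_of_nonneg _ _ (by positivity)]
          refine le_min ?_ ?_
          · rw [← hb]
            exact norm_stepIntegral_le hτ.le _ _
          · refine (norm_stepIntegral_le_div hτ hne _).trans_eq ?_
            rw [habs, hb]
            ring
        rw [stepKernel, enorm_mul, ← ofReal_norm (expSum n _), (hSP y).2, ofReal_norm,
          mul_left_comm, ← ENNReal.ofReal_mul (by positivity), ← ofReal_norm (stepIntegral _ _ _)]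
        gcongr
    _ ≤ ENNReal.ofReal (τ * (e * |P κ d η|)) * ENNReal.ofReal (C * e ^ (-(1 / κ) : ℝ)) := by
        rw [lintegral_const_mul' _ _ ENNReal.ofReal_ne_top]
        gcongr
        exact hC τ e A q hτ hτ1 he hA hAe hq n hn hnT
    _ = _ := by
        rw [← ENNReal.ofReal_mul (by positivity)]
        congr 1
        ring

lemma exists_lintegral_stepKernel_le (hκ : 2 ≤ κ) (hd : d κ = 1) {T : ℝ} (hT : 0 < T) :
    ∃ C : ℝ, 0 ≤ C ∧ ∀ τ e η : ℝ, 0 < τ → τ ≤ 1 → 0 < e → e ≤ 1 →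
      ∀ n : ℕ, 1 ≤ n → n * τ ≤ T →
      ∫⁻ ξ, ‖stepKernel κ d n τ e ξ η‖ₑ ≤
        ENNReal.ofReal (C * (τ * e ^ (1 - 1 / κ : ℝ)) * (1 + |η|) ^ (κ + 1)) := by
  obtain ⟨C, hC0, hC⟩ := exists_lintegral_outer_stepKernel_le hκ hd T
  set B := coeffNorm κ d with hB
  have hB1 : 1 ≤ B := one_le_coeffNorm hκ hd
  refine ⟨2 * T * B * (4 * B + 1) + 2 * C * B, by positivity,
    fun τ e η hτ hτ1 he he1 n hn hnT => ?_⟩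
  set h := 1 + |η| with hh
  have hh1 : 1 ≤ h := by linarith [abs_nonneg η]
  set w := e ^ (-(1 / κ) : ℝ) with hw
  have hw1 : 1 ≤ w := Real.one_le_rpow_of_pos_of_le_one_of_nonpos he he1
    (neg_nonpos.2 (by positivity))
  have hew : e ^ (1 - 1 / κ : ℝ) = e * w := by
    rw [sub_eq_add_neg, Real.rpow_add he, Real.rpow_one]
  set A := 4 * B * h + w with hA
  have hPη : |P κ d η| ≤ B * h ^ κ := abs_P_le hh1 (by linarith)
  have hBA : 2 * B ≤ A := by nlinarith
  have hwA : w ≤ A := by nlinarith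
  have hPA : |P κ d η| ≤ A ^ κ / 4 := by
    have h4 : 4 * B ≤ (4 * B) ^ κ := le_self_pow₀ (by linarith) (by omega)
    have : (4 * B * h) ^ κ ≤ A ^ κ := pow_le_pow_left₀ (by positivity) (by linarith) κ
    rw [mul_pow] at this
    nlinarith [pow_pos (by linarith : 0 < h) κ]
  have hA0 : 0 ≤ A := by positivity
  have hmid : ∫⁻ ξ in Set.Icc (-A) A, ‖stepKernel κ d n τ e ξ η‖ₑ ≤
      ENNReal.ofReal (n * (τ * (e * |P κ d η|) * τ) * (2 * A)) := by
    calc ∫⁻ ξ in Set.Icc (-A) A, ‖stepKernel κ d n τ e ξ η‖ₑ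
        ≤ ∫⁻ _ in Set.Icc (-A) A, ENNReal.ofReal (n * (τ * (e * |P κ d η|) * τ)) := by
          refine lintegral_mono fun ξ => ?_
          rw [← ofReal_norm]
          exact ENNReal.ofReal_le_ofReal (norm_stepKernel_le n hτ.le he.le ξ η)
      _ = _ := by
          rw [setLIntegral_const, Real.volume_Icc, ← ENNReal.ofReal_mul (by positivity)]
          ring_nf
  refine (lintegral_le_split_abs A _).trans ((add_le_add hmid (add_le_add
    (hC τ e A η hτ hτ1 he hBA hwA hPA n hn hnT id (Or.inl rfl))
    (hC τ e A η hτ hτ1 he hBA hwA hPA n hn hnT Neg.neg (Or.inr rfl)))).trans ?_)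
  rw [← ENNReal.ofReal_add (by positivity) (by positivity),
    ← ENNReal.ofReal_add (by positivity) (by positivity), hew]
  refine ENNReal.ofReal_le_ofReal ?_
  have hAw : A ≤ (4 * B + 1) * (h * w) := by
    nlinarith [mul_nonneg (sub_nonneg.2 hh1) (sub_nonneg.2 hw1)]
  have hbd1 : n * (τ * (e * |P κ d η|) * τ) * (2 * A) ≤
      2 * T * B * (4 * B + 1) * (τ * (e * w)) * h ^ (κ + 1) := by
    calc n * (τ * (e * |P κ d η|) * τ) * (2 * A)
        = (n * τ) * (τ * (e * |P κ d η|)) * (2 * A) := by ring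
      _ ≤ T * (τ * (e * (B * h ^ κ))) * (2 * ((4 * B + 1) * (h * w))) := by gcongr
      _ = _ := by ring
  have hbd2 : C * (τ * (e * |P κ d η|) * w) ≤ C * B * (τ * (e * w)) * h ^ (κ + 1) := by
    calc C * (τ * (e * |P κ d η|) * w) ≤ C * (τ * (e * (B * h ^ (κ + 1))) * w) := by
          gcongr
          exact hPη.trans (by gcongr; omega)
      _ = _ := by ring
  linarith

end Symbol

lemma En_eq_integral_stepKernel {κ : ℕ} {d : ℕ → ℝ} {ρ μ₀ : ℝ → ℂ} {ε α τ ξ : ℝ} (n : ℕ)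
    (hint : Integrable fun ξ₁ => ρ ξ₁ * μ₀ (ξ - ξ₁ / ε)) :
    En κ d ρ μ₀ ε α τ n ξ = ∫ ξ₁, ρ ξ₁ * μ₀ (ξ - ξ₁ / ε) *
      stepKernel κ d n τ (ε ^ α) ξ (ξ - ξ₁ / ε) := by
  have hP := continuous_P (κ := κ) (d := d)
  set e := ε ^ α with he
  set η : ℝ → ℝ := fun ξ₁ => ξ - ξ₁ / ε with hη
  have hηc : Continuous η := by fun_prop
  set phase : ℕ → ℝ → ℂ := fun k ξ₁ =>
    Complex.exp (Complex.I * Complex.ofReal (k * (τ * (e * P κ d ξ - e * P κ d (η ξ₁)))))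
    with hphase
  have hphasec : ∀ k, Continuous (phase k) := fun k => by fun_prop
  set osc : ℝ → ℝ → ℂ := fun s ξ₁ => Complex.exp (Complex.I * Complex.ofReal (s * (e * P κ d ξ))) *
    (Complex.exp (Complex.I * Complex.ofReal (-(s * (e * P κ d (η ξ₁))))) - 1) with hosc
  have hint' : ∀ k, Integrable fun ξ₁ => ρ ξ₁ * μ₀ (η ξ₁) * phase k ξ₁ := fun k =>
    hint.mul_bdd (c := 1) (hphasec k).aestronglyMeasurable (Filter.Eventually.of_forall fun ξ₁ =>
      (Complex.norm_exp_I_mul_ofReal _).le)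
  have hosc2 : ∀ s ξ₁, ‖osc s ξ₁‖ ≤ 2 := fun s ξ₁ => by
    simp only [hosc]
    rw [norm_mul, Complex.norm_exp_I_mul_ofReal, one_mul]
    refine (norm_sub_le _ _).trans ?_
    rw [Complex.norm_exp_I_mul_ofReal]
    norm_num
  have : IsFiniteMeasure (volume.restrict (Set.uIoc 0 τ)) := ⟨by simp [Set.uIoc]⟩
  have hstep : ∀ k : ℕ, (∫ s in (0 : ℝ)..τ, ∫ ξ₁ : ℝ,
        Complex.exp (Complex.I * Complex.ofReal (((k : ℝ) * τ + s) * e * P κ d ξ)) *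
          ρ ξ₁ *
          (Complex.exp (-Complex.I *
              Complex.ofReal (((k : ℝ) * τ + s) * e * P κ d (ξ - ξ₁ / ε))) -
            Complex.exp (-Complex.I *
              Complex.ofReal (((k : ℝ) * τ) * e * P κ d (ξ - ξ₁ / ε)))) *
          μ₀ (ξ - ξ₁ / ε)) =
      ∫ ξ₁, ρ ξ₁ * μ₀ (η ξ₁) * phase k ξ₁ * stepIntegral τ (e * P κ d ξ) (e * P κ d (η ξ₁)) := by
    intro k
    have hF : ∀ s ξ₁ : ℝ,
        Complex.exp (Complex.I * Complex.ofReal (((k : ℝ) * τ + s) * e * P κ d ξ)) *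
          ρ ξ₁ *
          (Complex.exp (-Complex.I *
              Complex.ofReal (((k : ℝ) * τ + s) * e * P κ d (ξ - ξ₁ / ε))) -
            Complex.exp (-Complex.I *
              Complex.ofReal (((k : ℝ) * τ) * e * P κ d (ξ - ξ₁ / ε)))) *
          μ₀ (ξ - ξ₁ / ε) = ρ ξ₁ * μ₀ (η ξ₁) * phase k ξ₁ * osc s ξ₁ := by
      intro s ξ₁
      have h : Complex.exp (Complex.I * Complex.ofReal (((k : ℝ) * τ + s) * e * P κ d ξ)) *
          (Complex.exp (-Complex.I *
              Complex.ofReal (((k : ℝ) * τ + s) * e * P κ d (η ξ₁))) -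
            Complex.exp (-Complex.I *
              Complex.ofReal (((k : ℝ) * τ) * e * P κ d (η ξ₁)))) =
          phase k ξ₁ * osc s ξ₁ := by
        simp only [hphase, hosc, mul_sub, ← Complex.exp_add, mul_one]
        push_cast
        congr 2 <;> ring
      calc _ = ρ ξ₁ * μ₀ (η ξ₁) * (Complex.exp (Complex.I *
              Complex.ofReal (((k : ℝ) * τ + s) * e * P κ d ξ)) *
            (Complex.exp (-Complex.I *
              Complex.ofReal (((k : ℝ) * τ + s) * e * P κ d (η ξ₁))) -
            Complex.exp (-Complex.I *
              Complex.ofReal (((k : ℝ) * τ) * e * P κ d (η ξ₁))))) := by ring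
        _ = _ := by rw [h]; ring
    simp_rw [hF]
    rw [intervalIntegral_integral_swap]
    · refine integral_congr_ae (Filter.Eventually.of_forall fun ξ₁ => ?_)
      exact intervalIntegral.integral_const_mul _ _
    · refine ((hint' k).comp_snd _).mul_bdd (c := 2) (Continuous.aestronglyMeasurable ?_)
        (Filter.Eventually.of_forall fun p => ?_)
      · fun_prop
      · exact hosc2 _ _
  rw [En, Finset.sum_congr rfl fun k _ => hstep k, ← integral_finsetSum]
  · refine integral_congr_ae (Filter.Eventually.of_forall fun ξ₁ => ?_)
    simp only [stepKernel, expSum, Finset.mul_sum, Finset.sum_mul, hphase, hη]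
    refine Finset.sum_congr rfl fun k _ => ?_
    ring
  · intro k _
    refine (hint' k).mul_bdd (c := 2 * |τ - 0|) ?_ (Filter.Eventually.of_forall fun ξ₁ => ?_)
    · exact ((continuous_stepIntegral τ).comp
        (by fun_prop : Continuous fun ξ₁ => (e * P κ d ξ, e * P κ d (η ξ₁)))).aestronglyMeasurable
    · exact intervalIntegral.norm_integral_le_of_norm_le_const fun s _ => hosc2 s ξ₁

lemma lintegral_comp_sub_div {ε : ℝ} (hε : 0 < ε) (ξ : ℝ) (F : ℝ → ℝ≥0∞) :
    ∫⁻ ξ₁, F (ξ - ξ₁ / ε) = ENNReal.ofReal ε * ∫⁻ η, F η := by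
  have hscale : ∫⁻ x, F (ξ - x / ε) =
      ∫⁻ y, F (ξ - y) ∂(Measure.map (fun x => x * ε⁻¹) (volume : Measure ℝ)) := by
    have := (Homeomorph.mulRight₀ ε⁻¹ (inv_ne_zero hε.ne')).measurableEmbedding.lintegral_map
      (μ := volume) fun y => F (ξ - y)
    exact this.symm
  rw [hscale, Real.map_volume_mul_right (inv_ne_zero hε.ne'), lintegral_smul_measure, inv_inv,
    abs_of_pos hε, lintegral_sub_left_eq_self F ξ, smul_eq_mul]

lemma integrable_one_add_abs_pow_mul {κ : ℕ} (hκ : 2 ≤ κ) {μ₀ : ℝ → ℂ} (hμm : Measurable μ₀)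
    (hμ1 : Integrable fun ξ : ℝ => (1 + |ξ| ^ κ) * ‖μ₀ ξ‖)
    (hμmom : Integrable fun ξ : ℝ => |ξ| ^ (2 * κ - 1) * ‖μ₀ ξ‖) :
    Integrable fun ξ : ℝ => (1 + |ξ|) ^ (κ + 1) * ‖μ₀ ξ‖ := by
  refine ((hμ1.add hμmom).const_mul (2 ^ (κ + 1))).mono'
    (by fun_prop) (Filter.Eventually.of_forall fun ξ => ?_)
  rw [Real.norm_of_nonneg (by positivity), Pi.add_apply, ← add_mul, ← mul_assoc]
  gcongr
  have hpos : 0 ≤ |ξ| := abs_nonneg ξ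
  have h1 : 0 ≤ |ξ| ^ κ := by positivity
  have h2 : 0 ≤ |ξ| ^ (2 * κ - 1) := by positivity
  rcases le_total |ξ| 1 with h | h
  · calc (1 + |ξ|) ^ (κ + 1) ≤ 2 ^ (κ + 1) := by
          gcongr
          linarith
      _ ≤ 2 ^ (κ + 1) * (1 + |ξ| ^ κ + |ξ| ^ (2 * κ - 1)) :=
          le_mul_of_one_le_right (by positivity) (by linarith)
  · calc (1 + |ξ|) ^ (κ + 1) ≤ (2 * |ξ|) ^ (κ + 1) := by
          gcongr
          linarith
      _ = 2 ^ (κ + 1) * |ξ| ^ (κ + 1) := mul_pow _ _ _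
      _ ≤ 2 ^ (κ + 1) * (1 + |ξ| ^ κ + |ξ| ^ (2 * κ - 1)) := by
          gcongr
          have : |ξ| ^ (κ + 1) ≤ |ξ| ^ (2 * κ - 1) := pow_le_pow_right₀ h (by omega)
          linarith

lemma lintegral_enorm_En_le {κ : ℕ} {d : ℕ → ℝ} {ρ μ₀ : ℝ → ℂ} {ε α τ : ℝ} (hε : 0 < ε)
    (hρm : Measurable ρ) (hρ : eLpNorm ρ ⊤ volume ≠ ⊤) (hμm : Measurable μ₀)
    (hμ : Integrable μ₀) (n : ℕ) :
    ∫⁻ ξ, ‖En κ d ρ μ₀ ε α τ n ξ‖ₑ ≤ eLpNorm ρ ⊤ volume * (ENNReal.ofReal ε *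
      ∫⁻ η, ‖μ₀ η‖ₑ * ∫⁻ ξ, ‖stepKernel κ d n τ (ε ^ α) ξ η‖ₑ) := by
  set M := eLpNorm ρ ⊤ volume with hM
  have hρle : ∀ᵐ ξ₁, ‖ρ ξ₁‖ₑ ≤ M := by
    rw [hM, eLpNorm_exponent_top]
    exact ae_le_eLpNormEssSup
  set K := stepKernel κ d n τ (ε ^ α) with hK
  have hKc : Continuous fun p : ℝ × ℝ => K p.1 p.2 := continuous_stepKernel n τ _
  have hEn : ∀ ξ, ‖En κ d ρ μ₀ ε α τ n ξ‖ₑ ≤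
      M * (ENNReal.ofReal ε * ∫⁻ η, ‖μ₀ η‖ₑ * ‖K ξ η‖ₑ) := by
    intro ξ
    have hint : Integrable fun ξ₁ => ρ ξ₁ * μ₀ (ξ - ξ₁ / ε) := by
      refine ((hμ.comp_sub_left ξ).comp_div hε.ne').bdd_mul (c := M.toReal)
        hρm.aestronglyMeasurable ?_
      filter_upwards [hρle] with ξ₁ h
      rw [← toReal_enorm]
      exact ENNReal.toReal_mono hρ h
    calc ‖En κ d ρ μ₀ ε α τ n ξ‖ₑ
        ≤ ∫⁻ ξ₁, ‖ρ ξ₁ * μ₀ (ξ - ξ₁ / ε) * K ξ (ξ - ξ₁ / ε)‖ₑ := by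
          rw [En_eq_integral_stepKernel n hint]
          exact enorm_integral_le_lintegral_enorm _
      _ ≤ ∫⁻ ξ₁, M * (‖μ₀ (ξ - ξ₁ / ε)‖ₑ * ‖K ξ (ξ - ξ₁ / ε)‖ₑ) := by
          refine lintegral_mono_ae ?_
          filter_upwards [hρle] with ξ₁ h
          rw [enorm_mul, enorm_mul, mul_assoc]
          gcongr
      _ = _ := by
          rw [lintegral_const_mul' _ _ hρ,
            lintegral_comp_sub_div hε ξ fun η => ‖μ₀ η‖ₑ * ‖K ξ η‖ₑ]
  refine (lintegral_mono hEn).trans_eq ?_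
  rw [lintegral_const_mul' _ _ hρ, lintegral_const_mul' _ _ ENNReal.ofReal_ne_top,
    lintegral_lintegral_swap]
  · congr 3
    ext η
    exact lintegral_const_mul _ (hKc.comp (by fun_prop : Continuous fun ξ => (ξ, η))).enorm.measurable
  · exact ((hμm.comp measurable_snd).enorm.mul hKc.enorm.measurable).aemeasurable

/-- Optimal estimate for the discrete first-order error term, under the extra
moment assumption `∫|ξ|^{2κ−1}|μ̂₀| < ∞`:
`∫|E_n| ≤ C τ ε^{1+(κ−1)α/κ} (1 + τ^{1−1/κ} log(1/ε))`,
with no coupling between `τ` and `ε`. -/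
theorem En_optimal_bound (κ : ℕ) (hκ : 2 ≤ κ) (d : ℕ → ℝ) (hd : d κ = 1)
    (α : ℝ) (hα : α ∈ Set.Icc (0:ℝ) (κ : ℝ)) (T : ℝ) (hT : 0 < T)
    (ρ : ℝ → ℂ) (hρm : Measurable ρ) (hρ1 : Integrable ρ)
    (hρinf : eLpNorm ρ ⊤ volume ≠ ⊤)
    (μ₀ : ℝ → ℂ) (hμm : Measurable μ₀)
    (hμ1 : Integrable (fun ξ : ℝ => (1 + |ξ| ^ κ) * ‖μ₀ ξ‖))
    (σ L₀ : ℝ) (hσ : 0 < σ) (hL₀ : 1 ≤ L₀)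
    (hρdecay : ∀ L : ℝ, L₀ ≤ L → (∫ ξ in {x : ℝ | L ≤ |x|}, ‖ρ ξ‖) ≤ L ^ (-σ))
    (hμdecay : ∀ L : ℝ, L₀ ≤ L →
      (∫ ξ in {x : ℝ | L ≤ |x|}, |ξ| ^ κ * ‖μ₀ ξ‖) ≤ L ^ (-σ))
    (hμinf : ∃ M : ℝ, ∀ᵐ ξ : ℝ, |ξ| ^ κ * ‖μ₀ ξ‖ ≤ M)
    (hμmom : Integrable (fun ξ : ℝ => |ξ| ^ (2 * κ - 1) * ‖μ₀ ξ‖)) :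
    ∃ τ₀ : ℝ, 0 < τ₀ ∧ ∃ ε₀ : ℝ, ε₀ ∈ Set.Ioo (0:ℝ) 1 ∧ ∃ C : ℝ, 0 < C ∧
      ∀ τ : ℝ, 0 < τ → τ ≤ τ₀ → ∀ ε : ℝ, 0 < ε → ε ≤ ε₀ →
        ∀ n : ℕ, 1 ≤ n → (n : ℝ) * τ ≤ T →
          (∫⁻ ξ : ℝ, (‖En κ d ρ μ₀ ε α τ n ξ‖₊ : ℝ≥0∞)) ≤
            ENNReal.ofReal (C * τ * ε ^ (1 + ((κ : ℝ) - 1) * α / κ) *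
              (1 + τ ^ (1 - 1 / (κ : ℝ)) * Real.log (1 / ε))) := by
  have hκ0 : (0 : ℝ) < κ := by exact_mod_cast (by omega : 0 < κ)
  obtain ⟨C, hC0, hC⟩ := exists_lintegral_stepKernel_le hκ hd hT
  set M := eLpNorm ρ ⊤ volume with hM
  have hmom := integrable_one_add_abs_pow_mul hκ hμm hμ1 hμmom
  set N := ∫ ξ : ℝ, (1 + |ξ|) ^ (κ + 1) * ‖μ₀ ξ‖ with hN
  have hN0 : 0 ≤ N := integral_nonneg fun ξ => by positivity
  have hμ : Integrable μ₀ := hμ1.mono hμm.aestronglyMeasurable <|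
    Filter.Eventually.of_forall fun ξ => by
      rw [Real.norm_of_nonneg (by positivity)]
      have : 0 ≤ |ξ| ^ κ := by positivity
      exact le_mul_of_one_le_left (norm_nonneg _) (by linarith)
  refine ⟨1, one_pos, 1 / 2, by norm_num, M.toReal * C * N + 1, by positivity,
    fun τ hτ hτ1 ε hε hε1 n hn hnT => ?_⟩
  have hε1' : ε ≤ 1 := by linarith
  have he : 0 < ε ^ α := by positivity
  have he1 : ε ^ α ≤ 1 := Real.rpow_le_one hε.le hε1' hα.1
  set w := τ * (ε ^ α) ^ (1 - 1 / κ : ℝ) with hw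
  have hw0 : 0 ≤ w := by positivity
  have hexp : ε * w = τ * ε ^ (1 + ((κ : ℝ) - 1) * α / κ) := by
    rw [hw, Real.rpow_add hε, Real.rpow_one, ← Real.rpow_mul hε.le,
      (by field_simp : α * (1 - 1 / (κ : ℝ)) = ((κ : ℝ) - 1) * α / κ)]
    ring
  have hlog : 1 ≤ 1 + τ ^ (1 - 1 / (κ : ℝ)) * Real.log (1 / ε) := by
    have : 0 ≤ Real.log (1 / ε) := Real.log_nonneg (by rwa [le_div_iff₀ hε, one_mul])
    have : 0 ≤ τ ^ (1 - 1 / (κ : ℝ)) * Real.log (1 / ε) := by positivity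
    linarith
  have hkernel : ∫⁻ η, ‖μ₀ η‖ₑ * ∫⁻ ξ, ‖stepKernel κ d n τ (ε ^ α) ξ η‖ₑ ≤
      ENNReal.ofReal (C * w * N) := by
    calc ∫⁻ η, ‖μ₀ η‖ₑ * ∫⁻ ξ, ‖stepKernel κ d n τ (ε ^ α) ξ η‖ₑ
        ≤ ∫⁻ η, ENNReal.ofReal (C * w * ((1 + |η|) ^ (κ + 1) * ‖μ₀ η‖)) := by
          refine lintegral_mono fun η => ?_
          rw [← mul_assoc, ENNReal.ofReal_mul (by positivity), ofReal_norm, mul_comm]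
          gcongr
          exact hC τ _ η hτ hτ1 he he1 n hn hnT
      _ = _ := by
          rw [← ofReal_integral_eq_lintegral_ofReal (hmom.const_mul _)
            (Filter.Eventually.of_forall fun η => by positivity), integral_const_mul]
  simp only [← enorm_eq_nnnorm]
  calc ∫⁻ ξ, ‖En κ d ρ μ₀ ε α τ n ξ‖ₑ
      ≤ M * (ENNReal.ofReal ε * ENNReal.ofReal (C * w * N)) := by
        refine (lintegral_enorm_En_le hε hρm hρinf hμm hμ n).trans ?_
        gcongr
    _ = ENNReal.ofReal (M.toReal * C * N * (ε * w)) := by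
        rw [← ENNReal.ofReal_toReal hρinf, ← ENNReal.ofReal_mul hε.le,
          ← ENNReal.ofReal_mul ENNReal.toReal_nonneg, ENNReal.toReal_ofReal ENNReal.toReal_nonneg]
        ring_nf
    _ ≤ _ := by
        refine ENNReal.ofReal_le_ofReal ?_
        rw [hexp, mul_assoc _ τ]
        have hx : 0 ≤ τ * ε ^ (1 + ((κ : ℝ) - 1) * α / κ) := by positivity
        refine le_trans ?_ (le_mul_of_one_le_right (by positivity) hlog)
        gcongr
        linarith
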